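/- arXiv:1905.13588 — 2 statements merged into one kernel-verified Lean document; each statement's English description precedes it below -/
import Mathlib

section
/- Let n ≥ 5, A, B ⊆ {1,…,n−1}, Q ⊆ {0,…,n−1}, and suppose Γ_n(A,B,Q) is properly given. If |Q| > 3, then Γ_n(A,B,Q) is non-planar. -/
/-- The circulant graph `circ_n(S)`: vertices `ZMod n`, with `i` adjacent to `i + s` for `s ∈ S`. -/
def circGraph (n : ℕ) (S : Finset ℕ) : SimpleGraph (ZMod n) :=
  SimpleGraph.fromRel (fun i j => ∃ s ∈ S, j = i + (s : ZMod n))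

/-- The graph `Γ_n(A,B,Q)` with vertices `v_i = Sum.inl i`, `v'_i = Sum.inr i`, and edges
`(v_i, v_{i+a})` for `a ∈ A`, `(v'_i, v'_{i+b})` for `b ∈ B`, `(v_i, v'_{i+q})` for `q ∈ Q`. -/
def Gamma (n : ℕ) (A B Q : Finset ℕ) : SimpleGraph (ZMod n ⊕ ZMod n) :=
  SimpleGraph.fromRel (fun x y =>
    match x, y with
    | Sum.inl i, Sum.inl j => ∃ a ∈ A, j = i + (a : ZMod n)
    | Sum.inr i, Sum.inr j => ∃ b ∈ B, j = i + (b : ZMod n)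
    | Sum.inl i, Sum.inr j => ∃ q ∈ Q, j = i + (q : ZMod n)
    | Sum.inr _, Sum.inl _ => False)

/-- `H` is a minor of `G`: there are disjoint connected branch sets in `G`, one for each
vertex of `H`, such that adjacent vertices of `H` have adjacent branch sets. -/
def SimpleGraph.IsMinorOf {W V : Type*} (H : SimpleGraph W) (G : SimpleGraph V) : Prop :=
  ∃ f : V → Option W,
    (∀ w : W, (G.induce {v | f v = some w}).Connected) ∧
    (∀ w₁ w₂ : W, H.Adj w₁ w₂ →
      ∃ v₁ v₂, f v₁ = some w₁ ∧ f v₂ = some w₂ ∧ G.Adj v₁ v₂)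

/-- A graph is planar iff it has no `K₅` minor and no `K_{3,3}` minor (Wagner's theorem). -/
def SimpleGraph.Planar {V : Type*} (G : SimpleGraph V) : Prop :=
  ¬ (⊤ : SimpleGraph (Fin 5)).IsMinorOf G ∧
  ¬ (completeBipartiteGraph (Fin 3) (Fin 3)).IsMinorOf G

/-- `Γ_n(A,B,Q)` is properly given: `a₁ ≢ ±a₂ (mod n)` for distinct `a₁, a₂ ∈ A`,
and similarly for `B`. -/
def ProperlyGiven (n : ℕ) (A B : Finset ℕ) : Prop :=
  (∀ a₁ ∈ A, ∀ a₂ ∈ A, a₁ ≠ a₂ →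
    (a₁ : ZMod n) ≠ (a₂ : ZMod n) ∧ (a₁ : ZMod n) ≠ -(a₂ : ZMod n)) ∧
  (∀ b₁ ∈ B, ∀ b₂ ∈ B, b₁ ≠ b₂ →
    (b₁ : ZMod n) ≠ (b₂ : ZMod n) ∧ (b₁ : ZMod n) ≠ -(b₂ : ZMod n))

/-- `circ_n(S)` is properly given: `s ≢ ±t (mod n)` for distinct `s, t ∈ S`. -/
def ProperlyGivenS (n : ℕ) (S : Finset ℕ) : Prop :=
  ∀ s ∈ S, ∀ t ∈ S, s ≠ t →
    (s : ZMod n) ≠ (t : ZMod n) ∧ (s : ZMod n) ≠ -(t : ZMod n)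

/-- A permutation is regular of order `n`: all its cycles have length exactly `n`
(for `n = 1` this means the identity). -/
def IsRegularOfOrder {α : Type*} (f : Equiv.Perm α) (n : ℕ) : Prop :=
  f ^ n = 1 ∧ ∀ x : α, ∀ k : ℕ, 0 < k → k < n → (f ^ k) x ≠ x

namespace SimpleGraph

universe u

/-- A minor model whose branch sets each contain a root reaching the whole branch set. -/
theorem IsMinorOf.of_reachable {W V : Type*} {H : SimpleGraph W} {G : SimpleGraph V}
    (f : V → Option W) (r : W → V) (hr : ∀ w, f (r w) = some w)
    (hf : ∀ v w, ∀ h : f v = some w,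
      (G.induce {v | f v = some w}).Reachable ⟨r w, hr w⟩ ⟨v, h⟩)
    (hadj : ∀ w₁ w₂, H.Adj w₁ w₂ → ∃ v₁ v₂, f v₁ = some w₁ ∧ f v₂ = some w₂ ∧ G.Adj v₁ v₂) :
    H.IsMinorOf G :=
  ⟨f, fun w => (connected_iff_exists_forall_reachable _).2
    ⟨⟨r w, hr w⟩, fun v => hf v.1 w v.2⟩, hadj⟩

/-- A minor model whose branch sets are stars. -/
theorem IsMinorOf.of_star {W V : Type*} {H : SimpleGraph W} {G : SimpleGraph V}
    (f : V → Option W) (r : W → V) (hr : ∀ w, f (r w) = some w)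
    (hf : ∀ v w, f v = some w → v = r w ∨ G.Adj (r w) v)
    (hadj : ∀ w₁ w₂, H.Adj w₁ w₂ → ∃ v₁ v₂, f v₁ = some w₁ ∧ f v₂ = some w₂ ∧ G.Adj v₁ v₂) :
    H.IsMinorOf G := by
  refine .of_reachable f r hr (fun v w h => ?_) hadj
  rcases hf v w h with rfl | h'
  · exact Reachable.refl _
  · exact Adj.reachable (by simpa using h')

theorem Hom.isMinorOf {W V : Type*} {H : SimpleGraph W} {G : SimpleGraph V} (φ : H →g G)
    (hφ : Function.Injective φ) : H.IsMinorOf G := by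
  have hp := hφ.isPartialInv
  refine .of_star (Function.partialInv φ) φ (fun w => (hp w (φ w)).2 rfl)
    (fun v w h => .inl ((hp w v).1 h).symm)
    (fun w₁ w₂ h => ⟨φ w₁, φ w₂, (hp _ _).2 rfl, (hp _ _).2 rfl, φ.map_adj h⟩)

theorem IsMinorOf.trans {U W V : Type*} {K : SimpleGraph U} {H : SimpleGraph W}
    {G : SimpleGraph V} (hKH : K.IsMinorOf H) (hHG : H.IsMinorOf G) : K.IsMinorOf G := by
  obtain ⟨g, hg, hg'⟩ := hKH
  obtain ⟨f, hf, hf'⟩ := hHG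
  have mem : ∀ {v a u}, f v = some a → g a = some u → (f v).bind g = some u := by
    intro v a u hv ha
    rw [hv, Option.bind_some, ha]
  refine ⟨fun v => (f v).bind g, fun u => ?_, fun u₁ u₂ h => ?_⟩
  · have key : ∀ a b : {w | g w = some u}, (H.induce {w | g w = some u}).Walk a b →
        ∀ v₁ v₂ (h₁ : f v₁ = some a.1) (h₂ : f v₂ = some b.1),
          (G.induce {v | (f v).bind g = some u}).Reachable
            ⟨v₁, mem h₁ a.2⟩ ⟨v₂, mem h₂ b.2⟩ := by
      have within : ∀ a : {w | g w = some u}, ∀ v₁ v₂ (h₁ : f v₁ = some a.1)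
          (h₂ : f v₂ = some a.1), (G.induce {v | (f v).bind g = some u}).Reachable
            ⟨v₁, mem h₁ a.2⟩ ⟨v₂, mem h₂ a.2⟩ := by
        intro a v₁ v₂ h₁ h₂
        have hsub : {v | f v = some a.1} ⊆ {v | (f v).bind g = some u} :=
          fun v hv => mem hv a.2
        exact ((hf a.1).preconnected ⟨v₁, h₁⟩ ⟨v₂, h₂⟩).map (induceHomOfLE G hsub).toHom
      intro a b p
      induction p with
      | nil => exact within _
      | @cons a c b hac p ih =>
        intro v₁ v₂ h₁ h₂
        obtain ⟨x, y, hx, hy, hxy⟩ := hf' _ _ (by simpa using hac)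
        refine (within a v₁ x h₁ hx).trans (Reachable.trans (Adj.reachable ?_) (ih y v₂ hy h₂))
        simpa using hxy
    obtain ⟨w⟩ := (hg u).nonempty
    obtain ⟨v⟩ := (hf w.1).nonempty
    have hv : f v.1 = some w.1 := v.2
    refine (connected_iff_exists_forall_reachable _).2
      ⟨⟨v.1, mem hv w.2⟩, fun v₂ => ?_⟩
    obtain ⟨b, hb, hb'⟩ := Option.bind_eq_some_iff.1 v₂.2
    obtain ⟨p⟩ := (hg u).preconnected w ⟨b, hb'⟩
    exact key _ _ p _ _ hv hb
  · obtain ⟨a, b, ha, hb, hab⟩ := hg' _ _ h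
    obtain ⟨x, y, hx, hy, hxy⟩ := hf' _ _ hab
    exact ⟨x, y, by simp [hx, ha], by simp [hy, hb], hxy⟩

theorem IsMinorOf.not_planar {W V : Type*} {H : SimpleGraph W} {G : SimpleGraph V}
    (h : H.IsMinorOf G) (hH : ¬ H.Planar) : ¬ G.Planar :=
  fun hG => hH ⟨fun h' => hG.1 (h'.trans h), fun h' => hG.2 (h'.trans h)⟩

/-- A minor of the neighbourhood of a vertex, together with that vertex, gives a larger
complete minor. -/
theorem IsMinorOf.cone {W V : Type*} {G : SimpleGraph V} {x : V}
    (h : (⊤ : SimpleGraph W).IsMinorOf (G.induce (G.neighborSet x))) :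
    (⊤ : SimpleGraph (Option W)).IsMinorOf G := by
  classical
  obtain ⟨f, hf, hf'⟩ := h
  let g : V → Option (Option W) := fun v =>
    if h : G.Adj x v then (f ⟨v, h⟩).map some else if v = x then some none else none
  have gx : g x = some none := by simp [g]
  have gN : ∀ v (h : G.Adj x v), g v = (f ⟨v, h⟩).map some := fun v h => by simp [g, h]
  have gsome : ∀ v w, g v = some (some w) → ∃ h : G.Adj x v, f ⟨v, h⟩ = some w := by
    intro v w h
    by_cases hv : G.Adj x v
    · exact ⟨hv, by simpa [gN v hv] using h⟩
    · by_cases hvx : v = x <;> simp [g, hv, hvx] at h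
  have gnone : ∀ v, g v = some none → v = x := by
    intro v h
    by_cases hv : G.Adj x v
    · simp [gN v hv] at h
    · by_contra hvx
      simp [g, hv, hvx] at h
  have cross : ∀ w, ∃ v, g v = some (some w) ∧ G.Adj x v := by
    intro w
    obtain ⟨v⟩ := (hf w).nonempty
    exact ⟨v.1.1, (gN _ v.1.2).trans (congrArg (Option.map some) v.2), v.1.2⟩
  refine ⟨g, fun w => ?_, fun w₁ w₂ h => ?_⟩
  · cases w with
    | none =>
      refine (connected_iff_exists_forall_reachable _).2 ⟨⟨x, gx⟩, fun v => ?_⟩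
      obtain ⟨v, hv⟩ := v
      obtain rfl := gnone v hv
      exact Reachable.refl _
    | some w =>
      let φ : (G.induce (G.neighborSet x)).induce {v | f v = some w} →g
          G.induce {v | g v = some (some w)} :=
        ⟨fun v => ⟨v.1.1, (gN _ v.1.2).trans (congrArg (Option.map some) v.2)⟩,
          fun {a b} h => by simpa using h⟩
      refine (hf w).map φ fun v => ?_
      obtain ⟨h, h'⟩ := gsome v.1 w v.2
      exact ⟨⟨⟨v.1, h⟩, h'⟩, rfl⟩
  · rcases w₁ with _ | w₁ <;> rcases w₂ with _ | w₂
    · simp at h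
    · obtain ⟨v, hv, hxv⟩ := cross w₂
      exact ⟨x, v, gx, hv, hxv⟩
    · obtain ⟨v, hv, hxv⟩ := cross w₁
      exact ⟨v, x, hv, gx, hxv.symm⟩
    · obtain ⟨v₁, v₂, h₁, h₂, h₁₂⟩ := hf' w₁ w₂ (by simpa using h)
      exact ⟨v₁.1, v₂.1, by rw [gN _ v₁.2]; simpa using h₁,
        by rw [gN _ v₂.2]; simpa using h₂, by simpa using h₁₂⟩

/-- Contracting the edge `x y` by deleting `y` and joining `x` to the neighbours of `y`. -/
def contractEdge {V : Type*} (G : SimpleGraph V) (x y : V) : SimpleGraph ({y}ᶜ : Set V) :=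
  (G ⊔ fromRel fun a b => a = x ∧ G.Adj y b).induce {y}ᶜ

theorem contractEdge_isMinorOf {V : Type*} {G : SimpleGraph V} {x y : V} (h : G.Adj x y) :
    (G.contractEdge x y).IsMinorOf G := by
  classical
  let f : V → Option ({y}ᶜ : Set V) := fun v =>
    if hv : v = y then some ⟨x, h.ne⟩ else some ⟨v, hv⟩
  have f1 : ∀ v : ({y}ᶜ : Set V), f v = some v := fun v => by
    have : (v : V) ≠ y := v.2
    simp [f, this]
  have f2 : f y = some ⟨x, h.ne⟩ := by simp [f]
  refine .of_star f Subtype.val f1 (fun v w hv => ?_) (fun w₁ w₂ hw => ?_)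
  · by_cases hvy : v = y
    · subst hvy
      rw [f2] at hv
      obtain rfl := Option.some.inj hv
      exact .inr h
    · simp only [f, hvy, dite_false, Option.some.injEq] at hv
      exact .inl (by rw [← hv])
  · simp only [contractEdge, comap_adj, sup_adj, fromRel_adj, Function.Embedding.subtype_apply] at hw
    rcases hw with hw | ⟨-, ⟨h₁, h₂⟩ | ⟨h₁, h₂⟩⟩
    · exact ⟨w₁, w₂, f1 _, f1 _, hw⟩
    · exact ⟨y, w₂, by rw [f2]; congr 1; exact Subtype.ext h₁.symm, f1 _, h₂⟩
    · exact ⟨w₁, y, f1 _, by rw [f2]; congr 1; exact Subtype.ext h₁.symm, h₂.symm⟩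

open scoped Classical in
theorem card_edgeFinset_le_contractEdge {V : Type*} [Fintype V] {G : SimpleGraph V} {x y : V}
    (h : G.Adj x y) :
    G.edgeFinset.card ≤ (G.contractEdge x y).edgeFinset.card + 1 +
      (G.neighborFinset x ∩ G.neighborFinset y).card := by
  set H := G ⊔ fromRel fun a b => a = x ∧ G.Adj y b with hH
  set N := (G.neighborFinset y \ G.neighborFinset x).erase x with hN
  have hdeg : H.degree y = G.degree y := by
    rw [← card_neighborFinset_eq_degree, ← card_neighborFinset_eq_degree]
    congr 1
    ext z
    simp only [mem_neighborFinset, hH, sup_adj, fromRel_adj]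
    constructor
    · rintro (hz | ⟨-, ⟨rfl, -⟩ | ⟨-, hz⟩⟩)
      · exact hz
      · exact absurd h (G.irrefl)
      · exact absurd hz (G.irrefl)
    · exact .inl
  have hcon : (G.contractEdge x y).edgeFinset.card = H.edgeFinset.card - H.degree y := by
    have := H.card_edgeFinset_deleteIncidenceSet y
    rw [← card_edgeFinset_induce_compl_singleton] at this
    convert this
    rfl
  have hcard : G.edgeFinset.card + N.card ≤ H.edgeFinset.card := by
    have hinj : Set.InjOn (fun z => s(x, z)) (N : Set V) := fun a _ b _ hab =>
      Sym2.congr_right.1 hab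
    rw [← Finset.card_image_of_injOn hinj, ← Finset.card_union_of_disjoint]
    · refine Finset.card_le_card (Finset.union_subset ?_ ?_)
      · exact edgeFinset_mono le_sup_left
      · intro e he
        obtain ⟨z, hz, rfl⟩ := Finset.mem_image.1 he
        simp only [hN, Finset.mem_erase, Finset.mem_sdiff, mem_neighborFinset] at hz
        simp only [mem_edgeFinset, mem_edgeSet, hH, sup_adj, fromRel_adj]
        exact .inr ⟨hz.1.symm, .inl ⟨by trivial, hz.2.1⟩⟩
    · rw [Finset.disjoint_right]
      intro e he
      obtain ⟨z, hz, rfl⟩ := Finset.mem_image.1 he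
      simp only [hN, Finset.mem_erase, Finset.mem_sdiff, mem_neighborFinset] at hz
      simpa using hz.2.2
  have hdegN : G.degree y ≤ N.card + 1 + (G.neighborFinset x ∩ G.neighborFinset y).card := by
    have h1 := Finset.card_sdiff_add_card_inter (G.neighborFinset y) (G.neighborFinset x)
    have h2 : (G.neighborFinset y \ G.neighborFinset x).card - 1 ≤ N.card :=
      Finset.pred_card_le_card_erase
    rw [card_neighborFinset_eq_degree, Finset.inter_comm] at h1
    omega
  omega

open scoped Classical in
/-- Mader's reduction: to find a minor in every graph with at least `t * |V| - s` edges, it is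
enough to find it in graphs all of whose edges lie in at least `t` triangles and which have a
vertex of positive degree less than `2 * t`. -/
theorem isMinorOf_of_card_edgeFinset {U : Type*} {K : SimpleGraph U} {t s k : ℕ} (hs : 1 ≤ s)
    (hk : k.choose 2 + s < t * k)
    (hK : ∀ (V : Type u) [Fintype V] (G : SimpleGraph V),
      (∀ x y, G.Adj x y → t ≤ (G.neighborFinset x ∩ G.neighborFinset y).card) →
      (∃ x, 0 < G.degree x ∧ G.degree x < 2 * t) → K.IsMinorOf G)
    (V : Type u) [Fintype V] (G : SimpleGraph V) (hV : k ≤ Fintype.card V)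
    (he : t * Fintype.card V ≤ G.edgeFinset.card + s) : K.IsMinorOf G := by
  induction hn : Fintype.card V using Nat.strong_induction_on generalizing V with
  | _ n ih =>
  subst hn
  have htk : t * k ≤ t * Fintype.card V := Nat.mul_le_mul_left t hV
  obtain ⟨E, hE, hEcard⟩ := Finset.exists_subset_card_eq
    (show t * Fintype.card V - s ≤ G.edgeFinset.card by omega)
  have hle : fromEdgeSet (E : Set (Sym2 V)) ≤ G := by
    rw [← fromEdgeSet_edgeSet G, ← coe_edgeFinset]
    exact fromEdgeSet_mono (by exact_mod_cast hE)
  obtain ⟨G', hle', he'⟩ : ∃ G' ≤ G, G'.edgeFinset.card + s = t * Fintype.card V := by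
    refine ⟨_, hle, ?_⟩
    have : (fromEdgeSet (E : Set (Sym2 V))).edgeFinset = E := by
      ext e
      simp only [mem_edgeFinset, edgeSet_fromEdgeSet, Set.mem_sdiff, Finset.mem_coe]
      exact ⟨fun h => h.1, fun h => ⟨h, G.not_isDiag_of_mem_edgeFinset (hE h)⟩⟩
    have hcard := congrArg Finset.card this
    convert (show E.card + s = t * Fintype.card V by omega) using 2
    convert hcard
  refine IsMinorOf.trans ?_ (Hom.isMinorOf (Hom.ofLE hle') fun _ _ h => h)
  clear hE hEcard hle hle' he E
  rename' he' => he, G => G₀, G' => G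
  have hV' : k < Fintype.card V := by
    refine lt_of_le_of_ne hV fun h => ?_
    have := G.card_edgeFinset_le_card_choose_two
    rw [← h] at this he
    omega
  have hcompl : ∀ v : V, Fintype.card ({v}ᶜ : Set V) + 1 = Fintype.card V := by
    intro v
    rw [Fintype.card_compl_set]
    simp
    omega
  obtain ⟨x, hx⟩ : ∃ x, G.degree x < 2 * t := by
    by_contra! hcon
    have h1 := Finset.sum_le_sum fun x (_ : x ∈ Finset.univ) => hcon x
    rw [G.sum_degrees_eq_twice_card_edges] at h1
    simp only [Finset.sum_const, Finset.card_univ, smul_eq_mul] at h1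
    nlinarith
  rcases Nat.eq_zero_or_pos (G.degree x) with h0 | h0
  · have hcard : (G.induce ({x}ᶜ : Set V)).edgeFinset.card = G.edgeFinset.card := by
      have := G.card_edgeFinset_deleteIncidenceSet x
      rw [← card_edgeFinset_induce_compl_singleton, h0, Nat.sub_zero] at this
      convert this
    have hc := hcompl x
    refine (ih _ (by omega) _ (G.induce ({x}ᶜ : Set V)) (by omega) ?_ rfl).trans
      (Hom.isMinorOf (Embedding.induce _).toHom (Embedding.induce (G := G) _).injective)
    have hle : t * Fintype.card ({x}ᶜ : Set V) ≤ G.edgeFinset.card + s := by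
      rw [he, ← hc]
      exact Nat.mul_le_mul_left t (by omega)
    rw [← hcard] at hle
    convert hle
  · by_cases hall : ∀ x y, G.Adj x y → t ≤ (G.neighborFinset x ∩ G.neighborFinset y).card
    · exact hK V G hall ⟨x, h0, hx⟩
    · push Not at hall
      obtain ⟨a, b, hab, hlt⟩ := hall
      have h1 := card_edgeFinset_le_contractEdge hab
      have hc := hcompl b
      refine (ih _ (by omega) _ (G.contractEdge a b) (by omega) ?_ rfl).trans
        (contractEdge_isMinorOf hab)
      rw [← hc, mul_add] at he
      omega

theorem completeGraph_isMinorOf_of_injective {W V : Type*} {G : SimpleGraph V} (φ : W → V)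
    (hφ : ∀ i j, i ≠ j → G.Adj (φ i) (φ j)) : (⊤ : SimpleGraph W).IsMinorOf G :=
  Hom.isMinorOf ⟨φ, fun h => hφ _ _ h⟩ fun i j h => by
    by_contra hij
    exact (hφ i j hij).ne h

open scoped Classical in
theorem completeGraph_four_isMinorOf (V : Type u) [Fintype V] (G : SimpleGraph V)
    (hV : 2 ≤ Fintype.card V) (he : 2 * Fintype.card V ≤ G.edgeFinset.card + 2) :
    (⊤ : SimpleGraph (Fin 4)).IsMinorOf G := by
  refine isMinorOf_of_card_edgeFinset (t := 2) (s := 2) (k := 2) (by norm_num) (by decide)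
    (fun V _ G hG ⟨x, h0, hx⟩ => ?_) V G hV he
  rw [← card_neighborFinset_eq_degree] at h0 hx
  obtain ⟨y, hy⟩ := Finset.card_pos.1 h0
  have hxy : G.Adj x y := by simpa using hy
  have hsub : ∀ v, G.neighborFinset x ∩ G.neighborFinset v ⊆ (G.neighborFinset x).erase v :=
    fun v w hw => by
      simp only [Finset.mem_inter, mem_neighborFinset, Finset.mem_erase] at hw ⊢
      exact ⟨hw.2.ne', hw.1⟩
  have heq : ∀ v, G.Adj x v →
      G.neighborFinset x ∩ G.neighborFinset v = (G.neighborFinset x).erase v := fun v hv =>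
    Finset.eq_of_subset_of_card_le (hsub v) <| by
      rw [Finset.card_erase_of_mem (by simpa using hv)]
      have := hG x v hv
      omega
  have hclique : ∀ v w, G.Adj x v → G.Adj x w → v ≠ w → G.Adj v w := by
    intro v w hv hw hvw
    have : w ∈ (G.neighborFinset x).erase v := by simp [hw, hvw.symm]
    rw [← heq v hv] at this
    simpa using (Finset.mem_inter.1 this).2
  obtain ⟨z, hz, w, hw, hzw⟩ := Finset.one_lt_card.1 (hG x y hxy)
  simp only [Finset.mem_inter, mem_neighborFinset] at hz hw
  have hzw' := hclique z w hz.1 hw.1 hzw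
  refine completeGraph_isMinorOf_of_injective ![x, y, z, w] fun i j hij => ?_
  fin_cases i <;> fin_cases j <;> simp_all [adj_comm]

open scoped Classical in
theorem completeGraph_five_isMinorOf (V : Type u) [Fintype V] (G : SimpleGraph V)
    (hV : 1 ≤ Fintype.card V) (he : 3 * Fintype.card V ≤ G.edgeFinset.card + 2) :
    (⊤ : SimpleGraph (Fin 5)).IsMinorOf G := by
  refine isMinorOf_of_card_edgeFinset (t := 3) (s := 2) (k := 1) (by norm_num) (by decide)
    (fun V _ G hG ⟨x, h0, hx⟩ => ?_) V G hV he
  have h54 : (⊤ : SimpleGraph (Fin 5)).IsMinorOf (⊤ : SimpleGraph (Option (Fin 4))) :=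
    completeGraph_isMinorOf_of_injective (finSuccEquiv 4) fun i j hij => by simpa using hij
  refine h54.trans (IsMinorOf.cone (x := x) ?_)
  set H := G.induce (G.neighborSet x) with hH
  have hcard : Fintype.card (G.neighborSet x) = G.degree x := G.card_neighborSet_eq_degree x
  have hdeg : ∀ v, 3 ≤ H.degree v := by
    intro v
    refine (hG x v v.2).trans ?_
    rw [← card_neighborFinset_eq_degree,
      ← Finset.card_map (Function.Embedding.subtype _)]
    refine Finset.card_le_card fun w hw => ?_
    simp only [Finset.mem_inter, mem_neighborFinset] at hw
    simp [hH, hw.1, hw.2]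
  have hsum := Finset.sum_le_sum fun v (_ : v ∈ Finset.univ) => hdeg v
  rw [H.sum_degrees_eq_twice_card_edges] at hsum
  simp only [Finset.sum_const, Finset.card_univ, smul_eq_mul] at hsum
  rw [← card_neighborFinset_eq_degree] at h0
  obtain ⟨y, hy⟩ := Finset.card_pos.1 h0
  have hlt := (hdeg ⟨y, by simpa using hy⟩).trans_lt (H.degree_lt_card_verts _)
  refine completeGraph_four_isMinorOf _ H ?_ ?_
  · omega
  · have : 2 * Fintype.card (G.neighborSet x) ≤ H.edgeFinset.card + 2 := by omega
    convert this

end SimpleGraph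

/-- The bipartite graph on two copies of `α` joining `i` to `i + q` for `q ∈ Q`. -/
def haarGraph {α : Type*} [AddCommGroup α] (Q : Finset α) : SimpleGraph (α ⊕ α) where
  Adj x y :=
    match x, y with
    | Sum.inl i, Sum.inr j => j - i ∈ Q
    | Sum.inr j, Sum.inl i => j - i ∈ Q
    | _, _ => False
  symm := ⟨fun x y h => by rcases x with x | x <;> rcases y with y | y <;> exact h⟩
  loopless := ⟨fun x h => by rcases x with x | x <;> exact h⟩

instance {α : Type*} [AddCommGroup α] [DecidableEq α] (Q : Finset α) :
    DecidableRel (haarGraph Q).Adj := fun x y => by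
  rcases x with x | x <;> rcases y with y | y <;> unfold haarGraph <;> infer_instance

instance {V W : Type*} : DecidableRel (completeBipartiteGraph V W).Adj := fun x y => by
  unfold completeBipartiteGraph; infer_instance

namespace haarGraph

open SimpleGraph Sum

section

variable {α β : Type*} [AddCommGroup α] [AddCommGroup β]

@[simp]
theorem adj_inl_inr {Q : Finset α} {i j : α} :
    (haarGraph Q).Adj (inl i) (inr j) ↔ j - i ∈ Q := Iff.rfl

@[simp]
theorem adj_inr_inl {Q : Finset α} {i j : α} :
    (haarGraph Q).Adj (inr j) (inl i) ↔ j - i ∈ Q := Iff.rfl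

@[simp]
theorem not_adj_inl_inl {Q : Finset α} {i j : α} :
    ¬ (haarGraph Q).Adj (inl i) (inl j) := id

@[simp]
theorem not_adj_inr_inr {Q : Finset α} {i j : α} :
    ¬ (haarGraph Q).Adj (inr i) (inr j) := id

theorem isMinorOf_of_addMonoidHom {Q : Finset α} {Q' : Finset β} (φ : α →+ β)
    (hφ : Function.Injective φ) (t : β) (h : ∀ q ∈ Q, φ q + t ∈ Q') :
    (haarGraph Q).IsMinorOf (haarGraph Q') := by
  refine Hom.isMinorOf ⟨Sum.map φ (fun j => φ j + t), ?_⟩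
    (Sum.map_injective.2 ⟨hφ, (add_left_injective t).comp hφ⟩)
  have key : ∀ i j, j - i ∈ Q → φ j + t - φ i ∈ Q' := fun i j hij => by
    have := h _ hij
    rwa [map_sub, sub_add_eq_add_sub] at this
  rintro (i | i) (j | j) hij
  · exact hij.elim
  · exact key i j hij
  · exact key j i hij
  · exact hij.elim

theorem not_planar_of_zmod {d : ℕ} {Q : Finset (ZMod d)} {Q' : Finset β} {x : β}
    (hx : addOrderOf x = d) (h : ∀ q ∈ Q, ∃ k : ℤ, (k : ZMod d) = q ∧ k • x ∈ Q')
    (hQ : ¬ (haarGraph Q).Planar) : ¬ (haarGraph Q').Planar := by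
  have hd : (d : ℤ) • x = 0 := by rw [← hx]; simp
  refine IsMinorOf.not_planar (isMinorOf_of_addMonoidHom
    (ZMod.lift d ⟨zmultiplesHom β x, by simpa using hd⟩) ?_ 0 fun q hq => ?_) hQ
  · rw [ZMod.lift_injective]
    intro m hm
    rw [ZMod.intCast_zmod_eq_zero_iff_dvd, ← hx]
    exact addOrderOf_dvd_iff_zsmul_eq_zero.2 (by simpa using hm)
  · obtain ⟨k, rfl, hk⟩ := h q hq
    simpa using hk

end

section Small

theorem not_planar_of_star {V : Type*} {G : SimpleGraph V} (f : V → Option (Fin 3 ⊕ Fin 3))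
    (r : Fin 3 ⊕ Fin 3 → V) (hr : ∀ w, f (r w) = some w)
    (hf : ∀ v w, f v = some w → v = r w ∨ G.Adj (r w) v)
    (hadj : ∀ w₁ w₂, (completeBipartiteGraph (Fin 3) (Fin 3)).Adj w₁ w₂ →
      ∃ v₁ v₂, f v₁ = some w₁ ∧ f v₂ = some w₂ ∧ G.Adj v₁ v₂) : ¬ G.Planar :=
  fun hG => hG.2 (.of_star f r hr hf hadj)

theorem not_planar_three : ¬ (haarGraph ({0, 1, -1} : Finset (ZMod 3))).Planar :=
  not_planar_of_star
    (Sum.elim ![some (inl 0), some (inl 1), some (inl 2)]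
      ![some (inr 0), some (inr 1), some (inr 2)])
    (Sum.elim (inl ∘ ![0, 1, 2]) (inr ∘ ![0, 1, 2])) (by decide) (by decide) (by decide)

theorem not_planar_four : ¬ (haarGraph ({0, 1, -1, 2} : Finset (ZMod 4))).Planar :=
  not_planar_of_star
    (Sum.elim ![some (inl 0), some (inl 1), some (inl 2), none]
      ![some (inr 0), some (inr 1), some (inr 2), none])
    (Sum.elim (inl ∘ ![0, 1, 2]) (inr ∘ ![0, 1, 2])) (by decide) (by decide) (by decide)

theorem not_planar_five : ¬ (haarGraph ({0, 1, -1} : Finset (ZMod 5))).Planar :=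
  not_planar_of_star
    (Sum.elim
      ![some (inr 0), some (inr 2), some (inr 1), some (inl 1), some (inl 2)]
      ![some (inl 2), some (inl 0), some (inr 2), some (inr 1), some (inr 0)])
    (Sum.elim ![inr 1, inl 3, inl 4] ![inr 4, inl 2, inr 2])
    (by decide) (by decide) (by decide)

theorem not_planar_six_two : ¬ (haarGraph ({0, 1, -1, 2} : Finset (ZMod 6))).Planar :=
  not_planar_of_star
    (Sum.elim
      ![none, none, some (inr 0), some (inr 1), some (inr 2), some (inl 0)]
      ![none, some (inr 0), none, some (inl 2), some (inl 1), some (inl 0)])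
    (Sum.elim ![inr 5, inr 4, inr 3] ![inl 2, inl 3, inl 4])
    (by decide) (by decide) (by decide)

theorem not_planar_six_three : ¬ (haarGraph ({0, 1, -1, 3} : Finset (ZMod 6))).Planar :=
  not_planar_of_star
    (Sum.elim
      ![some (inl 2), none, some (inl 0), none, some (inl 1), none]
      ![none, some (inr 0), none, some (inr 2), none, some (inr 1)])
    (Sum.elim ![inl 2, inl 4, inl 0] ![inr 1, inr 5, inr 3])
    (by decide) (by decide) (by decide)

theorem not_planar_eight_three : ¬ (haarGraph ({0, 1, -1, 3} : Finset (ZMod 8))).Planar :=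
  not_planar_of_star
    (Sum.elim
      ![some (inr 1), some (inr 2), none, none, none, some (inr 0), some (inl 1), some (inl 2)]
      ![some (inl 0), some (inl 1), some (inl 2), none, none, none, some (inr 0), some (inr 1)])
    (Sum.elim ![inr 0, inr 1, inr 2] ![inl 5, inl 0, inl 1])
    (by decide) (by decide) (by decide)

theorem not_planar_eight_one_two : ¬ (haarGraph ({0, 2, -2, 1} : Finset (ZMod 8))).Planar :=
  not_planar_of_star
    (Sum.elim
      ![none, some (inr 1), none, some (inl 1), some (inl 0), none, some (inr 2), some (inl 2)]
      ![none, some (inr 1), some (inl 0), none, some (inr 2), some (inr 0), none, some (inl 2)])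
    (Sum.elim ![inl 4, inl 3, inl 7] ![inr 5, inr 1, inr 4])
    (by decide) (by decide) (by decide)

end Small
section

variable {α : Type*} [AddCommGroup α]

/-- If no two other elements of `q` sum to `2 * q j`, contracting the matching of offset `q j`
gives a graph of minimum degree at least six. -/
theorem not_planar_of_forall_ne [Finite α] {Q : Finset α} {q : Fin 4 → α}
    (hq : Function.Injective q) (hQ : ∀ i, q i ∈ Q) (j : Fin 4)
    (hj : ∀ i k, i ≠ j → k ≠ j → q i + q k ≠ q j + q j) : ¬ (haarGraph Q).Planar := by
  classical
  have := Fintype.ofFinite α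
  let G : SimpleGraph α := SimpleGraph.fromRel fun x y => ∃ i, y - x = q i - q j
  have hminor : G.IsMinorOf (haarGraph Q) := by
    have step : ∀ x y i, y - x = q i - q j → ∃ v₁ v₂ : α ⊕ α,
        Sum.elim some (fun z => some (z - q j)) v₁ = some x ∧
        Sum.elim some (fun z => some (z - q j)) v₂ = some y ∧ (haarGraph Q).Adj v₁ v₂ := by
      intro x y i h
      refine ⟨inl x, inr (y + q j), by simp, by simp, ?_⟩
      rw [adj_inl_inr, add_sub_right_comm, h, sub_add_cancel]
      exact hQ i
    refine .of_star (Sum.elim some fun z => some (z - q j)) inl (fun _ => rfl) ?_ ?_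
    · rintro (v | v) w h
      · exact .inl (by simpa using h)
      · obtain rfl : v - q j = w := by simpa using h
        exact .inr (by simpa using hQ j)
    · rintro x y ⟨-, ⟨i, h⟩ | ⟨i, h⟩⟩
      · exact step x y i h
      · obtain ⟨v₁, v₂, h₁, h₂, h₁₂⟩ := step y x i h
        exact ⟨v₂, v₁, h₂, h₁, h₁₂.symm⟩
  have hdeg : ∀ x, 6 ≤ G.degree x := by
    intro x
    let φ : {i // i ≠ j} ⊕ {i // i ≠ j} → α :=
      Sum.elim (fun i => x + (q i - q j)) (fun i => x - (q i - q j))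
    have hne : ∀ i k : {i // i ≠ j}, q i - q j ≠ -(q k - q j) := fun i k h =>
      hj i k i.2 k.2 (by rw [← sub_eq_zero] at h ⊢; rw [← h]; abel)
    have hφ : Function.Injective φ := by
      refine Function.Injective.sumElim ?_ ?_ ?_
      · exact fun a b h => Subtype.ext (hq (by simpa using h))
      · exact fun a b h => Subtype.ext (hq (by simpa using h))
      · intro i k h
        rw [sub_eq_add_neg x] at h
        exact hne i k (add_left_cancel h)
    have hmem : ∀ a, φ a ∈ G.neighborFinset x := by
      have hne' : ∀ i : {i // i ≠ j}, q i - q j ≠ 0 := fun i h =>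
        i.2 (hq (sub_eq_zero.1 h))
      rintro (i | i) <;> simp only [mem_neighborFinset, φ, G, SimpleGraph.fromRel_adj, Sum.elim]
      · exact ⟨by simpa using hne' i, .inl ⟨i, by abel⟩⟩
      · exact ⟨fun h => hne' i (sub_eq_self.1 h.symm), .inr ⟨i, by abel⟩⟩
    have hcard := Finset.card_le_card
      (Finset.image_subset_iff.2 fun a (_ : a ∈ Finset.univ) => hmem a)
    rw [Finset.card_image_of_injective _ hφ, Finset.card_univ, Fintype.card_sum] at hcard
    simpa [Fintype.card_subtype_compl] using hcard
  have hsum := Finset.sum_le_sum fun x (_ : x ∈ Finset.univ) => hdeg x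
  rw [G.sum_degrees_eq_twice_card_edges] at hsum
  simp only [Finset.sum_const, Finset.card_univ, smul_eq_mul] at hsum
  have h5 : (⊤ : SimpleGraph (Fin 5)).IsMinorOf G := by
    refine completeGraph_five_isMinorOf α G (Fintype.card_pos_iff.2 ⟨0⟩) ?_
    have : 3 * Fintype.card α ≤ G.edgeFinset.card + 2 := by omega
    convert this
  exact fun hG => hG.1 (h5.trans hminor)

/-- The graph with offsets `{0, m} + {0, a}`, where `m` has order two, has a `K₃,₃` minor. -/
theorem not_planar_of_two_cosets [Finite α] [DecidableEq α] {a m : α} (hm : m + m = 0)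
    (hm0 : m ≠ 0) (ha : a ≠ 0) (ham : a ≠ m) :
    ¬ (haarGraph ({0, m, a, a + m} : Finset α)).Planar := by
  have hex : ∃ k, 0 < k ∧ (k • a = 0 ∨ k • a = m) :=
    ⟨addOrderOf a, addOrderOf_pos a, .inl (addOrderOf_nsmul_eq_zero a)⟩
  obtain ⟨k, ⟨hk0, hk⟩, hmin⟩ : ∃ k, (0 < k ∧ (k • a = 0 ∨ k • a = m)) ∧
      ∀ i, 0 < i → i < k → i • a ≠ 0 ∧ i • a ≠ m := by
    refine ⟨Nat.find hex, Nat.find_spec hex, fun i hi hik => ?_⟩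
    have := Nat.find_min hex hik
    tauto
  have hk2 : 2 ≤ k := by
    by_contra! h
    obtain rfl : k = 1 := by omega
    simp_all
  have hne_a : ∀ i, 2 ≤ i → i < k → i • a ≠ a := by
    intro i hi hik h
    refine (hmin (i - 1) (by omega) (by omega)).1 ?_
    obtain ⟨i, rfl⟩ := Nat.exists_eq_add_of_le' (show 1 ≤ i by omega)
    simpa [add_smul] using h
  let P : α ⊕ α → Prop := Sum.elim (fun x => ∃ i, 1 ≤ i ∧ i < k ∧ x = i • a)
    (fun x => ∃ i, 2 ≤ i ∧ i < k ∧ x = i • a)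
  classical
  let f : α ⊕ α → Option (Fin 3 ⊕ Fin 3) := fun v =>
    if v = inl 0 then some (inl 0) else if v = inl m then some (inl 1) else
    if v = inr 0 then some (inr 0) else if v = inr m then some (inr 1) else
    if v = inr a then some (inr 2) else if P v then some (inl 2) else none
  have fl : ∀ i, 1 ≤ i → i < k → f (inl (i • a)) = some (inl 2) := by
    intro i hi hik
    have h1 := hmin i (by omega) hik
    have h2 : P (inl (i • a)) := ⟨i, hi, hik, rfl⟩
    simp [f, h1, h2]
  have fr : ∀ i, 2 ≤ i → i < k → f (inr (i • a)) = some (inl 2) := by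
    intro i hi hik
    have h1 := hmin i (by omega) hik
    have h2 : P (inr (i • a)) := ⟨i, hi, hik, rfl⟩
    simp [f, h1, h2, hne_a i hi hik]
  have fa : f (inl a) = some (inl 2) := by simpa using fl 1 le_rfl hk2
  set G := haarGraph ({0, m, a, a + m} : Finset α) with hG
  have hreach : ∀ i (hi : 1 ≤ i) (hik : i < k),
      (G.induce {v | f v = some (inl 2)}).Reachable ⟨inl a, fa⟩ ⟨inl (i • a), fl i hi hik⟩ ∧
      ∀ hi2 : 2 ≤ i, (G.induce {v | f v = some (inl 2)}).Reachable ⟨inl a, fa⟩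
        ⟨inr (i • a), fr i hi2 hik⟩ := by
    intro i hi
    induction i, hi using Nat.le_induction with
    | base =>
      refine fun hik => ⟨?_, fun h => by omega⟩
      simp only [one_smul]
      exact Reachable.refl _
    | succ i hi ih =>
      intro hik
      have h1 : (G.induce {v | f v = some (inl 2)}).Adj ⟨inl (i • a), fl i hi (by omega)⟩
          ⟨inr ((i + 1) • a), fr (i + 1) (by omega) hik⟩ := by
        simp [hG, add_smul]
      have h2 : (G.induce {v | f v = some (inl 2)}).Adj
          ⟨inr ((i + 1) • a), fr (i + 1) (by omega) hik⟩
          ⟨inl ((i + 1) • a), fl (i + 1) (by omega) hik⟩ := by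
        simp [hG]
      have h3 := (ih (by omega)).1.trans h1.reachable
      exact ⟨h3.trans h2.reachable, fun _ => h3⟩
  let r : Fin 3 ⊕ Fin 3 → α ⊕ α := Sum.elim ![inl 0, inl m, inl a] ![inr 0, inr m, inr a]
  have hr : ∀ w, f (r w) = some w := by
    rintro (w | w) <;> fin_cases w <;> simp [r, f, hm0, ha, ham]
    simpa [f, ha, ham] using fa
  have hlast : ∃ v, f v = some (inl 2) ∧ G.Adj v (inr 0) ∧ G.Adj v (inr m) := by
    refine ⟨_, fl (k - 1) (by omega) (by omega), ?_⟩
    have hsub : (k - 1) • a = k • a - a := by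
      rw [← Nat.sub_add_cancel (show 1 ≤ k by omega), add_smul]
      simp
    have hmm : -m = m := neg_eq_of_add_eq_zero_left hm
    have hma : m + (a + m) = a := by rw [add_left_comm, hm, add_zero]
    rw [hsub]
    rcases hk with h | h <;> rw [h] <;> simp [hG, add_comm, sub_eq_add_neg, hmm, hma]
  have hadj : ∀ i j : Fin 3, ∃ v₁ v₂, f v₁ = some (inl i) ∧ f v₂ = some (inr j) ∧
      G.Adj v₁ v₂ := by
    have hmm : -m = m := neg_eq_of_add_eq_zero_left hm
    obtain ⟨v, hv, hv0, hvm⟩ := hlast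
    intro i j
    by_cases hij : i = 2 ∧ j ≠ 2
    · obtain ⟨rfl, hj⟩ := hij
      refine ⟨v, r (inr j), hv, hr _, ?_⟩
      fin_cases j
      · exact hv0
      · exact hvm
      · exact absurd rfl hj
    · refine ⟨r (inl i), r (inr j), hr _, hr _, ?_⟩
      fin_cases i <;> fin_cases j <;> simp_all [r, sub_eq_add_neg]
  refine fun hpl => hpl.2 (.of_reachable f r hr ?_ ?_)
  · intro v w hv
    by_cases hw : w = inl 2
    · subst hw
      by_cases hP : P v
      · rcases v with v | v
        · obtain ⟨i, hi, hik, rfl⟩ := hP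
          exact (hreach i hi hik).1
        · obtain ⟨i, hi, hik, rfl⟩ := hP
          exact (hreach i (by omega) hik).2 hi
      · exfalso
        simp only [f, hP, if_false] at hv
        split_ifs at hv <;> simp at hv
    · have : v = r w := by
        simp only [f] at hv
        split_ifs at hv <;> simp at hv <;> subst hv <;> first | assumption | exact absurd rfl hw
      subst this
      exact Reachable.refl _
  · rintro (i | i) (j | j) hij
    · simp at hij
    · exact hadj i j
    · obtain ⟨v₁, v₂, h₁, h₂, h⟩ := hadj j i
      exact ⟨v₂, v₁, h₂, h₁, h.symm⟩
    · simp at hij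

end

section

variable {n : ℕ}

theorem _root_.ZMod.eq_of_two_mul_eq_zero {x y : ZMod n} [NeZero n] (hx : 2 * x = 0)
    (hy : 2 * y = 0) (hx0 : x ≠ 0) (hy0 : y ≠ 0) : x = y := by
  have key : ∀ z : ZMod n, 2 * z = 0 → z ≠ 0 → 2 * z.val = n := by
    intro z hz hz0
    have h1 : ((2 * z.val : ℕ) : ZMod n) = 0 := by simpa using hz
    have h2 : z.val ≠ 0 := by simpa using hz0
    have h3 := z.val_lt
    obtain ⟨c, hc⟩ := (ZMod.natCast_eq_zero_iff _ _).1 h1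
    have : c = 1 := by
      have : c ≠ 0 := by rintro rfl; omega
      have : c < 2 := by
        by_contra! h
        have := Nat.mul_le_mul_left n h
        omega
      omega
    subst this
    omega
  exact ZMod.val_injective n (by have := key x hx hx0; have := key y hy hy0; omega)

theorem addOrderOf_eq_four {a : ZMod n} (h : 4 * a = 0) (h2 : 2 * a ≠ 0) : addOrderOf a = 4 :=
  addOrderOf_eq_prime_pow (p := 2) (n := 1) (by simpa using h2) (by simpa using h)

theorem addOrderOf_eq_eight {a : ZMod n} (h : 8 * a = 0) (h4 : 4 * a ≠ 0) : addOrderOf a = 8 :=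
  addOrderOf_eq_prime_pow (p := 2) (n := 2) (by simpa using h4) (by simpa using h)

theorem addOrderOf_eq_six {a : ZMod n} (h : 6 * a = 0) (h2 : 2 * a ≠ 0) (h3 : 3 * a ≠ 0) :
    addOrderOf a = 6 := by
  refine addOrderOf_eq_of_nsmul_and_div_prime_nsmul (by norm_num) (by simpa using h) ?_
  intro p hp hdvd
  have : p ≤ 6 := Nat.le_of_dvd (by norm_num) hdvd
  interval_cases p <;> simp_all +decide

theorem not_planar_of_three_mul_eq_zero {a : ZMod n} {Q : Finset (ZMod n)} (h : 3 * a = 0)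
    (ha : a ≠ 0) (hQ : {0, a, -a} ⊆ Q) : ¬ (haarGraph Q).Planar := by
  refine not_planar_of_zmod (addOrderOf_eq_prime (p := 3) (by simpa using h) ha) ?_
    not_planar_three
  simp only [Finset.insert_subset_iff, Finset.singleton_subset_iff] at hQ
  simp only [Finset.forall_mem_insert, Finset.mem_singleton, forall_eq]
  exact ⟨⟨0, by simp, by simp [hQ]⟩, ⟨1, by simp, by simp [hQ]⟩, ⟨-1, by simp, by simp [hQ]⟩⟩

theorem not_planar_of_four_mul_eq_zero {a : ZMod n} (h : 4 * a = 0) (h2 : 2 * a ≠ 0) :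
    ¬ (haarGraph {0, a, -a, 2 * a}).Planar := by
  refine not_planar_of_zmod (addOrderOf_eq_four h h2) ?_ not_planar_four
  simp only [Finset.forall_mem_insert, Finset.mem_singleton, forall_eq]
  exact ⟨⟨0, by simp⟩, ⟨1, by simp⟩, ⟨-1, by simp⟩, ⟨2, by simp⟩⟩

theorem not_planar_of_five_mul_eq_zero {a : ZMod n} {Q : Finset (ZMod n)} (h : 5 * a = 0)
    (ha : a ≠ 0) (hQ : {0, a, -a} ⊆ Q) : ¬ (haarGraph Q).Planar := by
  have : Fact (Nat.Prime 5) := ⟨by norm_num⟩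
  refine not_planar_of_zmod (addOrderOf_eq_prime (p := 5) (by simpa using h) ha) ?_
    not_planar_five
  simp only [Finset.insert_subset_iff, Finset.singleton_subset_iff] at hQ
  simp only [Finset.forall_mem_insert, Finset.mem_singleton, forall_eq]
  exact ⟨⟨0, by simp, by simp [hQ]⟩, ⟨1, by simp, by simp [hQ]⟩, ⟨-1, by simp, by simp [hQ]⟩⟩

theorem not_planar_of_six_mul_eq_zero {a c : ZMod n} (h : 6 * a = 0) (h2 : 2 * a ≠ 0)
    (h3 : 3 * a ≠ 0) (hc : c = 2 * a ∨ c = 3 * a) : ¬ (haarGraph {0, a, -a, c}).Planar := by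
  rcases hc with rfl | rfl
  · refine not_planar_of_zmod (addOrderOf_eq_six h h2 h3) ?_ not_planar_six_two
    simp only [Finset.forall_mem_insert, Finset.mem_singleton, forall_eq]
    exact ⟨⟨0, by simp⟩, ⟨1, by simp⟩, ⟨-1, by simp⟩, ⟨2, by simp⟩⟩
  · refine not_planar_of_zmod (addOrderOf_eq_six h h2 h3) ?_ not_planar_six_three
    simp only [Finset.forall_mem_insert, Finset.mem_singleton, forall_eq]
    exact ⟨⟨0, by simp⟩, ⟨1, by simp⟩, ⟨-1, by simp⟩, ⟨3, by simp⟩⟩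

theorem not_planar_of_eight_mul_eq_zero {a : ZMod n} (h : 8 * a = 0) (h4 : 4 * a ≠ 0) :
    ¬ (haarGraph {0, a, -a, 3 * a}).Planar := by
  refine not_planar_of_zmod (addOrderOf_eq_eight h h4) ?_ not_planar_eight_three
  simp only [Finset.forall_mem_insert, Finset.mem_singleton, forall_eq]
  exact ⟨⟨0, by simp⟩, ⟨1, by simp⟩, ⟨-1, by simp⟩, ⟨3, by simp⟩⟩

theorem not_planar_of_eight_mul_eq_zero' {c : ZMod n} (h : 8 * c = 0) (h4 : 4 * c ≠ 0) :
    ¬ (haarGraph {0, 2 * c, -(2 * c), c}).Planar := by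
  refine not_planar_of_zmod (addOrderOf_eq_eight h h4) ?_ not_planar_eight_one_two
  simp only [Finset.forall_mem_insert, Finset.mem_singleton, forall_eq]
  exact ⟨⟨0, by simp⟩, ⟨2, by simp⟩, ⟨-2, by simp⟩, ⟨1, by simp⟩⟩

/-- Offsets `0, a, -a, c` such that each of `a`, `-a` and `c` satisfies a relation making
the contraction of its matching lose edges. -/
theorem not_planar_of_midpoint [NeZero n] {a c : ZMod n} (h2 : 2 * a ≠ 0) (hc0 : c ≠ 0)
    (hca : c ≠ a) (hca' : c ≠ -a)
    (ha : 3 * a = 0 ∨ 4 * a = 0 ∨ c = 2 * a ∨ c = 3 * a ∨ 2 * c = 2 * a)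
    (ha' : 3 * a = 0 ∨ 4 * a = 0 ∨ c = -(2 * a) ∨ c = -(3 * a) ∨ 2 * c = -(2 * a))
    (hc : 2 * c = 0 ∨ 2 * c = a ∨ 2 * c = -a ∨ 2 * c = 2 * a ∨ 2 * c = -(2 * a)) :
    ¬ (haarGraph {0, a, -a, c}).Planar := by
  have ha0 : a ≠ 0 := by rintro rfl; simp at h2
  have hsymm : ({0, -a, - -a, c} : Finset (ZMod n)) = {0, a, -a, c} := by
    rw [neg_neg, Finset.insert_comm (-a) a]
  by_cases h3 : 3 * a = 0
  · exact not_planar_of_three_mul_eq_zero h3 ha0 (by grind)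
  by_cases h4 : 4 * a = 0
  · have hcases : c = 2 * a ∨ 2 * c = a ∨ 2 * c = -a := by
      have h22 : 2 * (2 * a) = 0 := by linear_combination h4
      have hsub : 2 * (c - a) = 0 → c = 2 * a := fun h => by
        by_contra
        have := ZMod.eq_of_two_mul_eq_zero h h22 (sub_ne_zero.2 hca) h2
        exact hca' (by linear_combination this + h4)
      rcases hc with h | h | h | h | h
      · exact .inl (ZMod.eq_of_two_mul_eq_zero h h22 hc0 h2)
      · exact .inr (.inl h)
      · exact .inr (.inr h)
      · exact .inl (hsub (by linear_combination h))
      · exact .inl (hsub (by linear_combination h - h4))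
    rcases hcases with rfl | rfl | h
    · exact not_planar_of_four_mul_eq_zero h4 h2
    · exact not_planar_of_eight_mul_eq_zero' (by linear_combination h4)
        fun h => h2 (by linear_combination h)
    · obtain rfl : a = -(2 * c) := by linear_combination h
      rw [← hsymm, neg_neg]
      exact not_planar_of_eight_mul_eq_zero' (by linear_combination -h4)
        fun h => h2 (by linear_combination -h)
  simp only [h3, h4, false_or] at ha ha'
  have five : 5 * a = 0 → ¬ (haarGraph {0, a, -a, c}).Planar := fun h =>
    not_planar_of_five_mul_eq_zero h ha0 (by grind)
  have six : 6 * a = 0 → (c = 2 * a ∨ c = 3 * a ∨ c = -(2 * a)) →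
      ¬ (haarGraph {0, a, -a, c}).Planar := by
    rintro h (hc | hc | hc)
    · exact not_planar_of_six_mul_eq_zero h h2 h3 (.inl hc)
    · exact not_planar_of_six_mul_eq_zero h h2 h3 (.inr hc)
    · rw [← hsymm]
      exact not_planar_of_six_mul_eq_zero (by linear_combination -h)
        (fun h => h2 (by linear_combination -h)) (fun h => h3 (by linear_combination -h))
        (.inl (by linear_combination hc))
  have eight : 8 * a = 0 → (c = 3 * a ∨ c = -(3 * a)) →
      ¬ (haarGraph {0, a, -a, c}).Planar := by
    rintro h (rfl | hc)
    · exact not_planar_of_eight_mul_eq_zero h h4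
    · rw [← hsymm]
      obtain rfl : c = 3 * -a := by linear_combination hc
      exact not_planar_of_eight_mul_eq_zero (by linear_combination -h)
        (fun h => h4 (by linear_combination -h))
  rcases ha with h | h | h <;> rcases ha' with h' | h' | h'
  · exact absurd (by linear_combination h' - h) h4
  · exact five (by linear_combination h' - h)
  · exact six (by linear_combination h' - 2 * h) (.inl h)
  · exact five (by linear_combination h' - h)
  · exact six (by linear_combination h' - h) (.inr (.inl h))
  · exact eight (by linear_combination h' - 2 * h) (.inl h)
  · exact six (by linear_combination 2 * h' - h) (.inr (.inr h'))
  · exact eight (by linear_combination 2 * h' - h) (.inr h')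
  · exact absurd (by linear_combination h' - h) h4

theorem not_planar_of_three_lt_card [NeZero n] {Q : Finset (ZMod n)} (hcard : 3 < Q.card) :
    ¬ (haarGraph Q).Planar := by
  obtain ⟨Q', hQ', hcard'⟩ := Finset.exists_subset_card_eq (show 4 ≤ Q.card by omega)
  let e := (Q'.equivFinOfCardEq hcard').symm
  let q : Fin 4 → ZMod n := fun i => e i
  have hq : Function.Injective q := fun i j h => e.injective (Subtype.ext h)
  have hqQ : ∀ i, q i ∈ Q := fun i => hQ' (e i).2
  by_contra hpl
  have hbad : ∀ j, ∃ i k, i ≠ j ∧ k ≠ j ∧ q i + q k = q j + q j := by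
    intro j
    by_contra! h
    exact not_planar_of_forall_ne hq hqQ j h hpl
  have translate : ∀ (R : Finset (ZMod n)) (t : ZMod n), (∀ x ∈ R, ∃ i, q i = x + t) →
      (haarGraph R).Planar := by
    intro R t h
    by_contra hR
    refine (isMinorOf_of_addMonoidHom (AddMonoidHom.id _) Function.injective_id t
      fun x hx => ?_).not_planar hR hpl
    obtain ⟨i, hi⟩ := h x hx
    exact hi ▸ hqQ i
  by_cases hmid : ∃ j i k, i ≠ j ∧ k ≠ j ∧ i ≠ k ∧ q i + q k = q j + q j
  · obtain ⟨j, i, k, hij, hkj, hik, h⟩ := hmid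
    obtain ⟨l, hlj, hli, hlk, hall⟩ : ∃ l, l ≠ j ∧ l ≠ i ∧ l ≠ k ∧
        ∀ x : Fin 4, x = j ∨ x = i ∨ x = k ∨ x = l := by
      clear h
      revert i j k
      decide
    have hk : q k = q j + q j - q i := by linear_combination h
    have qij := hq.ne hij
    have qik := hq.ne hik
    have qlj := hq.ne hlj
    have qli := hq.ne hli
    have qlk := hq.ne hlk
    refine not_planar_of_midpoint (a := q i - q j) (c := q l - q j) ?_ ?_ ?_ ?_ ?_ ?_ ?_
      (translate _ (q j) ?_)
    · grind
    · grind
    · grind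
    · grind
    · obtain ⟨x, y, hx, hy, hxy⟩ := hbad i
      rcases hall x with rfl | rfl | rfl | rfl <;> rcases hall y with rfl | rfl | rfl | rfl <;>
        grind
    · obtain ⟨x, y, hx, hy, hxy⟩ := hbad k
      rcases hall x with rfl | rfl | rfl | rfl <;> rcases hall y with rfl | rfl | rfl | rfl <;>
        grind
    · obtain ⟨x, y, hx, hy, hxy⟩ := hbad l
      rcases hall x with rfl | rfl | rfl | rfl <;> rcases hall y with rfl | rfl | rfl | rfl <;>
        grind
    · simp only [Finset.forall_mem_insert, Finset.mem_singleton, forall_eq]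
      exact ⟨⟨j, by ring⟩, ⟨i, by ring⟩, ⟨k, by rw [hk]; ring⟩, ⟨l, by ring⟩⟩
  · have htwo : ∀ j, ∃ i, i ≠ j ∧ 2 * (q i - q j) = 0 := by
      intro j
      obtain ⟨i, k, hi, hk, h⟩ := hbad j
      by_cases hik : i = k
      · subst hik
        exact ⟨i, hi, by linear_combination h⟩
      · exact absurd ⟨j, i, k, hi, hk, hik, h⟩ hmid
    obtain ⟨i, hi, him⟩ := htwo 0
    obtain ⟨j, hj0, hji⟩ : ∃ j : Fin 4, j ≠ 0 ∧ j ≠ i := by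
      clear him
      revert i
      decide
    obtain ⟨k, hk, hkm⟩ := htwo j
    have hkeq : q k - q j = q i - q 0 := ZMod.eq_of_two_mul_eq_zero hkm him
      (sub_ne_zero.2 (hq.ne hk)) (sub_ne_zero.2 (hq.ne hi))
    refine not_planar_of_two_cosets (m := q i - q 0) (a := q j - q 0) (by linear_combination him)
      (sub_ne_zero.2 (hq.ne hi)) (sub_ne_zero.2 (hq.ne hj0))
      (fun h => hq.ne hji (sub_left_injective h)) (translate _ (q 0) ?_)
    simp only [Finset.forall_mem_insert, Finset.mem_singleton, forall_eq]
    exact ⟨⟨0, by ring⟩, ⟨i, by ring⟩, ⟨j, by ring⟩, ⟨k, by linear_combination hkeq⟩⟩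

theorem isMinorOf_Gamma (A B Q : Finset ℕ) :
    (haarGraph (Q.image ((↑) : ℕ → ZMod n))).IsMinorOf (Gamma n A B Q) := by
  refine Hom.isMinorOf ⟨id, ?_⟩ Function.injective_id
  have key : ∀ i j : ZMod n, j - i ∈ Q.image ((↑) : ℕ → ZMod n) →
      (Gamma n A B Q).Adj (inl i) (inr j) := by
    intro i j h
    obtain ⟨q, hq, hqij⟩ := Finset.mem_image.1 h
    exact ⟨by simp, .inl ⟨q, hq, by rw [hqij]; ring⟩⟩
  rintro (i | i) (j | j) h
  · exact h.elim
  · exact key i j h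
  · exact (key j i h).symm
  · exact h.elim

end

end haarGraph

theorem stmt13 (n : ℕ) (hn : 5 ≤ n) (A B Q : Finset ℕ)
    (hA : A ⊆ Finset.Ico 1 n) (hB : B ⊆ Finset.Ico 1 n) (hQ : Q ⊆ Finset.range n)
    (hpg : ProperlyGiven n A B) (hcard : 3 < Q.card) :
    ¬ (Gamma n A B Q).Planar := by
  have : NeZero n := ⟨by omega⟩
  refine (haarGraph.isMinorOf_Gamma A B Q).not_planar (haarGraph.not_planar_of_three_lt_card ?_)
  rwa [Finset.card_image_of_injOn]
  intro a ha b hb hab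
  have := (ZMod.natCast_eq_natCast_iff' a b n).1 hab
  rwa [Nat.mod_eq_of_lt (Finset.mem_range.1 (hQ ha)),
    Nat.mod_eq_of_lt (Finset.mem_range.1 (hQ hb))] at this
end

section
/- Let n ≥ 1, A, B ⊆ {1,…,n−1}, Q ⊆ {0,…,n−1} with Q ≠ ∅, and suppose Γ_n(A,B,Q) is properly given. If |A| = |B| = 2, then Γ_n(A,B,Q) is non-planar. -/
namespace SimpleGraph

variable {V : Type*} {G : SimpleGraph V}

/-- The sets `S` and `T` are disjoint and joined by an edge of `G`. -/
def Touch (G : SimpleGraph V) (S T : Set V) : Prop :=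
  Disjoint S T ∧ ∃ x ∈ S, ∃ y ∈ T, G.Adj x y

theorem Touch.symm {S T : Set V} (h : G.Touch S T) : G.Touch T S := by
  obtain ⟨hd, x, hx, y, hy, hxy⟩ := h
  exact ⟨hd.symm, y, hy, x, hx, hxy.symm⟩

/-- Branch sets of a complete minor on `k` vertices. -/
structure IsCliqueModel (G : SimpleGraph V) {k : ℕ} (S : Fin k → Set V) : Prop where
  connected : ∀ i, (G.induce (S i)).Connected
  touch : ∀ i j, i ≠ j → G.Touch (S i) (S j)

theorem IsCliqueModel.nil : G.IsCliqueModel (![] : Fin 0 → Set V) :=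
  ⟨fun i => i.elim0, fun i => i.elim0⟩

theorem IsCliqueModel.cons {k : ℕ} {S : Fin k → Set V} (h : G.IsCliqueModel S) {D : Set V}
    (hD : (G.induce D).Connected) (hDS : ∀ i, G.Touch D (S i)) :
    G.IsCliqueModel (Matrix.vecCons D S) := by
  refine ⟨fun i => ?_, fun i j hij => ?_⟩
  · cases i using Fin.cases with
    | zero => exact hD
    | succ i => exact h.connected i
  · cases i using Fin.cases with
    | zero =>
      cases j using Fin.cases with
      | zero => exact absurd rfl hij
      | succ j => exact hDS j
    | succ i =>
      cases j using Fin.cases with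
      | zero => exact (hDS i).symm
      | succ j => exact h.touch i j fun e => hij (congrArg Fin.succ e)

theorem IsCliqueModel.isMinorOf {k : ℕ} {S : Fin k → Set V} (h : G.IsCliqueModel S) :
    (⊤ : SimpleGraph (Fin k)).IsMinorOf G := by
  classical
  have key : ∃ f : V → Option (Fin k), ∀ v i, f v = some i ↔ v ∈ S i := by
    refine ⟨fun v => if hv : ∃ i, v ∈ S i then some hv.choose else none, fun v i => ?_⟩
    by_cases hv : ∃ i, v ∈ S i
    · simp only [hv, dif_pos, Option.some.injEq]
      refine ⟨fun e => e ▸ hv.choose_spec, fun hi => ?_⟩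
      by_contra hne
      exact Set.disjoint_left.1 (h.touch _ _ hne).1 hv.choose_spec hi
    · simp only [hv, dif_neg, not_false_eq_true, reduceCtorEq, false_iff]
      exact fun hi => hv ⟨i, hi⟩
  obtain ⟨f, hf⟩ := key
  refine ⟨f, fun i => ?_, fun i j hij => ?_⟩
  · have : {v | f v = some i} = S i := Set.ext fun v => hf v i
    rw [this]
    exact h.connected i
  · obtain ⟨-, x, hx, y, hy, hxy⟩ := h.touch i j hij
    exact ⟨x, y, (hf x i).2 hx, (hf y j).2 hy, hxy⟩

theorem Connected.induce_image {W : Type*} {H : SimpleGraph W} (φ : G →g H) {S : Set V}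
    (hS : (G.induce S).Connected) : (H.induce (φ '' S)).Connected := by
  refine hS.map (induceHom φ (Set.mapsTo_image φ S)) ?_
  rintro ⟨_, x, hx, rfl⟩
  exact ⟨⟨x, hx⟩, rfl⟩

theorem IsCliqueModel.image {W : Type*} {H : SimpleGraph W} {k : ℕ} {S : Fin k → Set V}
    (h : G.IsCliqueModel S) (φ : G →g H) (hφ : Function.Injective φ) :
    H.IsCliqueModel fun i => φ '' S i := by
  refine ⟨fun i => (h.connected i).induce_image φ, fun i j hij => ?_⟩
  obtain ⟨hd, x, hx, y, hy, hxy⟩ := h.touch i j hij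
  exact ⟨(Set.disjoint_image_iff hφ).2 hd, φ x, ⟨x, hx, rfl⟩, φ y, ⟨y, hy, rfl⟩, φ.map_adj hxy⟩

theorem connected_induce_image_Icc (φ : ℕ → V) (hφ : ∀ i, G.Adj (φ i) (φ (i + 1))) {s t : ℕ}
    (hst : s ≤ t) : (G.induce (φ '' Set.Icc s t)).Connected := by
  induction t, hst using Nat.le_induction with
  | base =>
    rw [Set.Icc_self, Set.image_singleton]
    exact (connected_iff _).2 ⟨Preconnected.of_subsingleton, ⟨⟨φ s, rfl⟩⟩⟩
  | succ t hst ih =>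
    have : φ '' Set.Icc s (t + 1) = φ '' Set.Icc s t ∪ {φ (t + 1)} := by
      rw [← Set.image_singleton, ← Set.image_union]
      congr 1
      ext i
      simp only [Set.mem_Icc, Set.mem_union, Set.mem_singleton_iff]
      omega
    rw [this]
    exact connected_induce_union ih.preconnected Preconnected.of_subsingleton
      ⟨t, ⟨hst, le_rfl⟩, rfl⟩ rfl (hφ t)

variable {M : Type*} [AddCommGroup M]

/-- The Cayley graph on `M` with connection set `T`. -/
def cayley (T : Set M) : SimpleGraph M :=
  fromRel fun i j => ∃ t ∈ T, j = i + t

theorem cayley_adj_add {T : Set M} {t : M} (ht : t ∈ T) (ht0 : t ≠ 0) (i : M) :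
    (cayley T).Adj i (i + t) :=
  ⟨by simpa using ht0, Or.inl ⟨t, ht, rfl⟩⟩

theorem connected_cayley_induce_coset {T T' : Set M} (hT : T' ⊆ T) (c : M) :
    ((cayley T).induce {x | x - c ∈ AddSubgroup.closure T'}).Connected := by
  set S : Set M := {x | x - c ∈ AddSubgroup.closure T'}
  have key : ∀ h ∈ AddSubgroup.closure T', ∀ x y : S, (y : M) = x + h →
      ((cayley T).induce S).Reachable x y := by
    intro h hh
    induction hh using AddSubgroup.closure_induction with
    | mem t ht =>
      intro x y hxy
      by_cases hne : x = y
      · rw [hne]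
      · exact Adj.reachable (G := (cayley T).induce S)
          ⟨fun e => hne (Subtype.ext e), Or.inl ⟨t, hT ht, hxy⟩⟩
    | zero =>
      intro x y hxy
      rw [Subtype.ext (hxy.trans (add_zero _))]
    | add g h hg _ ihg ihh =>
      intro x y hxy
      have hz : (x : M) + g ∈ S := by
        have := add_mem x.2 hg
        rwa [sub_add_eq_add_sub] at this
      exact (ihg x ⟨_, hz⟩ rfl).trans (ihh ⟨_, hz⟩ y (by rw [hxy, add_assoc]))
    | neg g _ ih =>
      intro x y hxy
      exact (ih y x (by rw [hxy, neg_add_cancel_right])).symm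
  refine (connected_iff _).2 ⟨fun x y => key (y - x) ?_ x y (by abel), ⟨⟨c, ?_⟩⟩⟩
  · have := sub_mem (show (y : M) - c ∈ AddSubgroup.closure T' from y.2) x.2
    rwa [sub_sub_sub_cancel_right] at this
  · simp [S, zero_mem]

theorem exists_cliqueModel_cayley_of_two_nsmul_ne_zero [Finite M] {T : Set M} {a b : M}
    (haT : a ∈ T) (hbT : b ∈ T) (ha2 : 2 • a ≠ 0) (hb : b ≠ 0) (hab : a ≠ b) (hab' : a ≠ -b) :
    ∃ S : Fin 4 → Set M, (cayley T).IsCliqueModel S ∧ ∀ i, S i ⊆ AddSubgroup.closure T := by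
  have ha : a ≠ 0 := by
    rintro rfl
    simp at ha2
  have hm : 3 ≤ addOrderOf a := by
    have h0 : 0 < addOrderOf a := addOrderOf_pos a
    have h1 : addOrderOf a ≠ 1 := fun h => ha (AddMonoid.addOrderOf_eq_one_iff.1 h)
    have h2 : addOrderOf a ≠ 2 := fun h => ha2 (h ▸ addOrderOf_nsmul_eq_zero a)
    omega
  set m := addOrderOf a
  have hadj (i : ℕ) : (cayley T).Adj (i • a) ((i + 1) • a) := by
    rw [succ_nsmul]
    exact cayley_adj_add haT ha _
  have hlast : (cayley T).Adj (0 • a) ((m - 1) • a) := by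
    have h := hadj (m - 1)
    rw [Nat.sub_add_cancel (by omega), addOrderOf_nsmul_eq_zero a, ← zero_nsmul a] at h
    exact h.symm
  have hconn {s t : ℕ} (hst : s ≤ t) :
      ((cayley T).induce ((fun i : ℕ => i • a) '' Set.Icc s t)).Connected :=
    connected_induce_image_Icc _ hadj hst
  have htouch {s t s' t' : ℕ} (i j : ℕ) (hts : t < s') (ht : t' < m) (hi : i ∈ Set.Icc s t)
      (hj : j ∈ Set.Icc s' t') (hij : (cayley T).Adj (i • a) (j • a)) :
      (cayley T).Touch ((fun i : ℕ => i • a) '' Set.Icc s t)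
        ((fun i : ℕ => i • a) '' Set.Icc s' t') := by
    refine ⟨Set.disjoint_left.2 ?_, _, ⟨i, hi, rfl⟩, _, ⟨j, hj, rfl⟩, hij⟩
    rintro _ ⟨p, hp, rfl⟩ ⟨q, hq, hqp⟩
    have := nsmul_injOn_Iio_addOrderOf (Set.mem_Iio.2 (hq.2.trans_lt ht))
      (Set.mem_Iio.2 ((hp.2.trans_lt hts).trans_le (hq.1.trans (hq.2.trans ht.le)))) hqp
    have := hp.2
    have := hq.1
    omega
  have hsub (s t : ℕ) :
      (fun i : ℕ => i • a) '' Set.Icc s t ⊆ (AddSubgroup.closure T : Set M) := by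
    rintro _ ⟨i, -, rfl⟩
    exact nsmul_mem (AddSubgroup.subset_closure haT) i
  by_cases hbm : b ∈ AddSubgroup.zmultiples a
  · obtain ⟨k, hk, rfl⟩ : ∃ k < m, k • a = b := by
      classical
      rw [mem_zmultiples_iff_mem_range_addOrderOf] at hbm
      simpa using hbm
    have hk0 : k ≠ 0 := by
      rintro rfl
      simp at hb
    have hk1 : k ≠ 1 := by
      rintro rfl
      simp at hab
    have hkm : k + 1 ≠ m := by
      intro h
      refine hab' (eq_neg_of_add_eq_zero_right ?_)
      rw [← succ_nsmul, h, addOrderOf_nsmul_eq_zero]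
    have hk' (i : ℕ) : (cayley T).Adj (i • a) ((i + k) • a) := by
      rw [add_nsmul]
      exact cayley_adj_add hbT hb _
    refine ⟨_, (((IsCliqueModel.nil.cons (hconn (s := k + 1) (t := m - 1) (by omega))
      fun i => i.elim0).cons (hconn (le_refl k)) ?_).cons
      (hconn (s := 1) (t := k - 1) (by omega)) ?_).cons (hconn (le_refl 0)) ?_, ?_⟩
    · simp only [Fin.forall_fin_one, Matrix.cons_val_zero]
      exact htouch k (k + 1) (by omega) (by omega) ⟨by omega, by omega⟩
        ⟨by omega, by omega⟩ (hadj k)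
    · simp only [Fin.forall_fin_two, Matrix.cons_val_zero, Matrix.cons_val_one]
      refine ⟨htouch (k - 1) k (by omega) (by omega) ⟨by omega, by omega⟩
        ⟨by omega, by omega⟩ ?_, htouch 1 (1 + k) (by omega) (by omega) ⟨by omega, by omega⟩
        ⟨by omega, by omega⟩ (hk' 1)⟩
      have h := hadj (k - 1)
      rwa [Nat.sub_add_cancel (by omega)] at h
    · simp only [Fin.forall_fin_succ, Matrix.cons_val_zero, Matrix.cons_val_succ]
      refine ⟨htouch 0 1 (by omega) (by omega) ⟨by omega, by omega⟩
        ⟨by omega, by omega⟩ (hadj 0), htouch 0 (0 + k) (by omega) (by omega)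
        ⟨by omega, by omega⟩ ⟨by omega, by omega⟩ (hk' 0), htouch 0 (m - 1) (by omega) (by omega)
        ⟨by omega, by omega⟩ ⟨by omega, by omega⟩ hlast, fun i => i.elim0⟩
    · simp only [Fin.forall_fin_succ, Matrix.cons_val_zero, Matrix.cons_val_succ]
      exact ⟨hsub _ _, hsub _ _, hsub _ _, hsub _ _, fun i => i.elim0⟩
  · set D : Set M := {x | x - b ∈ AddSubgroup.closure {a}}
    have hD : ((cayley T).induce D).Connected :=
      connected_cayley_induce_coset (Set.singleton_subset_iff.2 haT) b
    have hmul (i : ℕ) : i • a ∈ AddSubgroup.closure {a} :=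
      nsmul_mem (AddSubgroup.mem_closure_singleton_self a) i
    have hDt {s t : ℕ} (hst : s ≤ t) :
        (cayley T).Touch ((fun i : ℕ => i • a) '' Set.Icc s t) D := by
      refine ⟨Set.disjoint_left.2 ?_, s • a, ⟨s, ⟨le_rfl, hst⟩, rfl⟩, s • a + b, ?_,
        cayley_adj_add hbT hb _⟩
      · rintro _ ⟨i, -, rfl⟩ hi
        have := sub_mem (hmul i) hi
        rw [sub_sub_cancel, ← AddSubgroup.zmultiples_eq_closure] at this
        exact hbm this
      · simpa [D] using hmul s
    refine ⟨_, (((IsCliqueModel.nil.cons hD fun i => i.elim0).cons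
      (hconn (s := 2) (t := m - 1) (by omega)) ?_).cons (hconn (le_refl 1)) ?_).cons
      (hconn (le_refl 0)) ?_, ?_⟩
    · simp only [Fin.forall_fin_one, Matrix.cons_val_zero]
      exact hDt (by omega)
    · simp only [Fin.forall_fin_two, Matrix.cons_val_zero, Matrix.cons_val_one]
      exact ⟨htouch 1 2 (by omega) (by omega) ⟨by omega, by omega⟩
        ⟨by omega, by omega⟩ (hadj 1), hDt le_rfl⟩
    · simp only [Fin.forall_fin_succ, Matrix.cons_val_zero, Matrix.cons_val_succ]
      exact ⟨htouch 0 1 (by omega) (by omega) ⟨by omega, by omega⟩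
        ⟨by omega, by omega⟩ (hadj 0), htouch 0 (m - 1) (by omega) (by omega)
        ⟨by omega, by omega⟩ ⟨by omega, by omega⟩ hlast, hDt le_rfl, fun i => i.elim0⟩
    · simp only [Fin.forall_fin_succ, Matrix.cons_val_zero, Matrix.cons_val_succ]
      refine ⟨hsub _ _, hsub _ _, hsub _ _, fun x hx => ?_, fun i => i.elim0⟩
      have h := add_mem (AddSubgroup.closure_mono (Set.singleton_subset_iff.2 haT) hx)
        (AddSubgroup.subset_closure hbT)
      rwa [sub_add_cancel] at h

theorem exists_cliqueModel_five {T U : Set M} (u : cayley T →g G) (w : cayley U →g G)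
    (hu : Function.Injective u) (hw : Function.Injective w) (huw : ∀ i j, u i ≠ w j)
    (hadj : ∀ i, G.Adj (u i) (w i))
    (hT : ∃ S : Fin 4 → Set M, (cayley T).IsCliqueModel S ∧ ∀ i, S i ⊆ AddSubgroup.closure T)
    (hU : ∃ S : Fin 4 → Set M, (cayley U).IsCliqueModel S ∧ ∀ i, S i ⊆ AddSubgroup.closure U) :
    ∃ S : Fin 5 → Set V, G.IsCliqueModel S := by
  by_cases hle : AddSubgroup.closure U ≤ AddSubgroup.closure T
  · obtain ⟨S, hS, hSU⟩ := hU
    refine ⟨_, (hS.image w hw).cons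
      ((connected_cayley_induce_coset (Set.Subset.refl T) 0).induce_image u) fun i => ?_⟩
    obtain ⟨⟨x, hx⟩⟩ := (hS.connected i).nonempty
    refine ⟨Set.disjoint_left.2 ?_, u x, ⟨x, ?_, rfl⟩, w x, ⟨x, hx, rfl⟩, hadj x⟩
    · rintro _ ⟨p, -, rfl⟩ ⟨q, -, hq⟩
      exact huw p q hq.symm
    · simpa using hle (hSU i hx)
  · obtain ⟨c, hcU, hcT⟩ := Set.not_subset.1 hle
    obtain ⟨S, hS, hST⟩ := hT
    set C : Set M := {x | x - c ∈ AddSubgroup.closure T}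
    have hC : (G.induce (u '' C)).Connected :=
      (connected_cayley_induce_coset (Set.Subset.refl T) c).induce_image u
    have hcC : c ∈ C := by simp [C, zero_mem]
    set D : Set M := {x | ∃ h ∈ AddSubgroup.closure T, x - h ∈ AddSubgroup.closure U}
    refine ⟨_, (hS.image u hu).cons (D := u '' C ∪ w '' D)
      (G.induce_connected_of_patches (u c) (Or.inl ⟨c, hcC, rfl⟩) ?_) fun i => ?_⟩
    · rintro v (hv | ⟨x, ⟨h, hh, hx⟩, rfl⟩)
      · exact ⟨u '' C, Set.subset_union_left, ⟨c, hcC, rfl⟩, hv, hC.preconnected _ _⟩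
      · have hE : (G.induce (w '' {x | x - h ∈ AddSubgroup.closure U})).Connected :=
          (connected_cayley_induce_coset (Set.Subset.refl U) h).induce_image w
        refine ⟨u '' C ∪ w '' {x | x - h ∈ AddSubgroup.closure U},
          Set.union_subset_union_right _ (Set.image_mono fun y hy => ⟨h, hh, hy⟩),
          Or.inl ⟨c, hcC, rfl⟩, Or.inr ⟨x, hx, rfl⟩,
          (connected_induce_union hC.preconnected hE.preconnected ⟨h + c, ?_, rfl⟩
            ⟨h + c, ?_, rfl⟩ (hadj _)).preconnected _ _⟩
        · simpa [C] using hh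
        · simpa using hcU
    · obtain ⟨⟨x, hx⟩⟩ := (hS.connected i).nonempty
      refine ⟨Set.disjoint_left.2 ?_, w x, Or.inr ⟨x, ⟨x, hST i hx, ?_⟩, rfl⟩, u x,
        ⟨x, hx, rfl⟩, (hadj x).symm⟩
      · rintro _ (⟨p, hp, rfl⟩ | ⟨p, -, rfl⟩) ⟨q, hq, hqp⟩
        · rw [hu hqp] at hq
          have := sub_mem (hST i hq) hp
          rw [sub_sub_cancel] at this
          exact hcT this
        · exact huw q p hqp
      · simp [zero_mem]

end SimpleGraph

open SimpleGraph

theorem exists_cliqueModel_cayley_zmod {n : ℕ} [NeZero n] {A : Finset ℕ}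
    (hA : A ⊆ Finset.Ico 1 n) (hcard : A.card = 2)
    (hpg : ∀ a₁ ∈ A, ∀ a₂ ∈ A, a₁ ≠ a₂ →
      (a₁ : ZMod n) ≠ (a₂ : ZMod n) ∧ (a₁ : ZMod n) ≠ -(a₂ : ZMod n)) :
    ∃ S : Fin 4 → Set (ZMod n), (cayley ((fun a : ℕ => (a : ZMod n)) '' A)).IsCliqueModel S ∧
      ∀ i, S i ⊆ AddSubgroup.closure ((fun a : ℕ => (a : ZMod n)) '' (A : Set ℕ)) := by
  obtain ⟨a, b, hab, rfl⟩ := Finset.card_eq_two.1 hcard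
  have ha := Finset.mem_Ico.1 (hA (show a ∈ ({a, b} : Finset ℕ) by simp))
  have hb := Finset.mem_Ico.1 (hA (show b ∈ ({a, b} : Finset ℕ) by simp))
  have hne {c : ℕ} (hc : 1 ≤ c ∧ c < n) : (c : ZMod n) ≠ 0 := by
    rw [Ne, ZMod.natCast_eq_zero_iff]
    exact Nat.not_dvd_of_pos_of_lt hc.1 hc.2
  have htwo {c : ℕ} (hc : 1 ≤ c ∧ c < n) (h : 2 • (c : ZMod n) = 0) : 2 * c = n := by
    rw [nsmul_eq_mul, ← Nat.cast_mul, ZMod.natCast_eq_zero_iff] at h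
    obtain ⟨k, hk⟩ := h
    have : 0 < k := Nat.pos_of_ne_zero (by rintro rfl; omega)
    have : k < 2 := by nlinarith
    obtain rfl : k = 1 := by omega
    omega
  have haT : (a : ZMod n) ∈ (fun a : ℕ => (a : ZMod n)) '' (({a, b} : Finset ℕ) : Set ℕ) :=
    ⟨a, by simp, rfl⟩
  have hbT : (b : ZMod n) ∈ (fun a : ℕ => (a : ZMod n)) '' (({a, b} : Finset ℕ) : Set ℕ) :=
    ⟨b, by simp, rfl⟩
  by_cases h2 : 2 • (a : ZMod n) = 0
  · obtain ⟨h₁, h₂⟩ := hpg b (by simp) a (by simp) hab.symm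
    refine exists_cliqueModel_cayley_of_two_nsmul_ne_zero hbT haT (fun h => ?_) (hne ha) h₁ h₂
    have := htwo ha h2
    have := htwo hb h
    omega
  · obtain ⟨h₁, h₂⟩ := hpg a (by simp) b (by simp) hab
    exact exists_cliqueModel_cayley_of_two_nsmul_ne_zero haT hbT h2 (hne hb) h₁ h₂

theorem stmt14 (n : ℕ) (hn : 1 ≤ n) (A B Q : Finset ℕ)
    (hA : A ⊆ Finset.Ico 1 n) (hB : B ⊆ Finset.Ico 1 n) (hQ : Q ⊆ Finset.range n)
    (hQne : Q.Nonempty) (hpg : ProperlyGiven n A B)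
    (hAcard : A.card = 2) (hBcard : B.card = 2) :
    ¬ (Gamma n A B Q).Planar := by
  have : NeZero n := ⟨by omega⟩
  obtain ⟨q, hq⟩ := hQne
  rintro ⟨h5, -⟩
  let u : cayley ((fun a : ℕ => (a : ZMod n)) '' (A : Set ℕ)) →g Gamma n A B Q :=
    { toFun := Sum.inl
      map_rel' := by
        rintro i j ⟨hij, h⟩
        refine ⟨by simpa using hij, ?_⟩
        rcases h with ⟨_, ⟨a, ha, rfl⟩, h⟩ | ⟨_, ⟨a, ha, rfl⟩, h⟩
        · exact Or.inl ⟨a, ha, h⟩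
        · exact Or.inr ⟨a, ha, h⟩ }
  let w : cayley ((fun b : ℕ => (b : ZMod n)) '' (B : Set ℕ)) →g Gamma n A B Q :=
    { toFun := fun i => Sum.inr (i + q)
      map_rel' := by
        rintro i j ⟨hij, h⟩
        refine ⟨by simpa using hij, ?_⟩
        rcases h with ⟨_, ⟨b, hb, rfl⟩, rfl⟩ | ⟨_, ⟨b, hb, rfl⟩, rfl⟩
        · exact Or.inl ⟨b, hb, add_right_comm _ _ _⟩
        · exact Or.inr ⟨b, hb, add_right_comm _ _ _⟩ }
  obtain ⟨S, hS⟩ := exists_cliqueModel_five u w Sum.inl_injective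
    (fun i j h => add_right_cancel (Sum.inr_injective h)) (fun _ _ => Sum.inl_ne_inr)
    (fun i => ⟨Sum.inl_ne_inr, Or.inl ⟨q, hq, rfl⟩⟩)
    (exists_cliqueModel_cayley_zmod hA hAcard hpg.1)
    (exists_cliqueModel_cayley_zmod hB hBcard hpg.2)
  exact h5 hS.isMinorOf
end
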